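/- Let ε > 0 and let Q ⊂ ℤ be an interval of cardinality |Q| ≥ M^{α−1+ε}, and for a dyadic integer N with M^θ ≤ N ≤ M set ρ_{N,Q}(x) = (1/|Q|)·(μ_N∗1_Q)(x). Then there exist constants δ > 0 and C > 0 (depending only on α, ε, θ, φ) such that for every h ∈ ℤ: Σ_{x∈ℤ} |ρ_{N,Q}(x+h) − ρ_{N,Q}(x)| ≤ C·(|h|/N^α)^δ (the ℓ¹ Hölder estimate, obtained from the ℓ² estimate by the Cauchy–Schwarz inequality using that the differences are supported in a set of cardinality O(N^α + |h|)). -/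

import Mathlib

open scoped BigOperators

/-- `μ_N(x) = Σ_{N ≤ m ≤ 2N, ⌊m^α⌋ = x} φ(m/N)/m`. -/
noncomputable def mu (φ : ℝ → ℝ) (α : ℝ) (N : ℕ) (x : ℤ) : ℝ :=
  ∑ m ∈ Finset.Icc N (2 * N),
    if (⌊(m : ℝ) ^ α⌋ : ℤ) = x then φ ((m : ℝ) / (N : ℝ)) / (m : ℝ) else 0

/-- `ρ_{N,Q} = μ_N ∗ (1_Q/|Q|)` for the interval `Q = [a,b] ∩ ℤ`. -/
noncomputable def rhoNQ (φ : ℝ → ℝ) (α : ℝ) (N : ℕ) (a b : ℤ) (x : ℤ) : ℝ :=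
  (1 / ((Finset.Icc a b).card : ℝ)) * ∑ y ∈ Finset.Icc a b, mu φ α N (x - y)

noncomputable section

/-- The density of the push-forward of `φ(v)/v dv` under `v ↦ v ^ α`. -/
def powDensity (φ : ℝ → ℝ) (α z : ℝ) : ℝ :=
  if 0 < z then φ (z ^ (1 / α)) / (α * z) else 0

/-- The antiderivative of `powDensity φ α`. -/
def powPrimitive (φ : ℝ → ℝ) (α z : ℝ) : ℝ := ∫ s in (0 : ℝ)..z, powDensity φ α s

variable {φ : ℝ → ℝ} {α : ℝ}

lemma powDensity_eq_zero_of_le_one (hφ : Function.support φ ⊆ Set.Ioo 1 2) (hα : 1 ≤ α)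
    {z : ℝ} (hz : z ≤ 1) : powDensity φ α z = 0 := by
  unfold powDensity
  split_ifs with h
  · have h1 : z ^ (1 / α) ≤ 1 := Real.rpow_le_one h.le hz (by positivity)
    have : φ (z ^ (1 / α)) = 0 := by
      by_contra h0
      exact absurd (hφ h0).1 (not_lt.2 h1)
    rw [this, zero_div]
  · rfl

lemma powDensity_eq_zero_of_four_le (hφ : Function.support φ ⊆ Set.Ioo 1 2) (hα : 1 ≤ α)
    (hα2 : α ≤ 2) {z : ℝ} (hz : 4 ≤ z) : powDensity φ α z = 0 := by
  have h0 : 0 < α := by linarith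
  have h1 : (2 : ℝ) ≤ z ^ (1 / α) := by
    rw [one_div, Real.le_rpow_inv_iff_of_pos (by norm_num) (by linarith) h0]
    calc (2 : ℝ) ^ α ≤ 2 ^ (2 : ℝ) := Real.rpow_le_rpow_of_exponent_le (by norm_num) hα2
      _ = 4 := by norm_num
      _ ≤ z := hz
  have : φ (z ^ (1 / α)) = 0 := by
    by_contra h
    exact absurd (hφ h).2 (not_lt.2 h1)
  rw [powDensity, this, zero_div, ite_self]

lemma contDiff_powDensity (hs : ContDiff ℝ (⊤ : ℕ∞) φ) (hφ : Function.support φ ⊆ Set.Ioo 1 2)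
    (hα : 1 ≤ α) : ContDiff ℝ 1 (powDensity φ α) := by
  rw [contDiff_iff_contDiffAt]
  intro z
  rcases lt_or_ge z 1 with hz | hz
  · refine (contDiffAt_const (c := (0 : ℝ))).congr_of_eventuallyEq ?_
    filter_upwards [Iio_mem_nhds hz] with y hy
    exact powDensity_eq_zero_of_le_one hφ hα (le_of_lt hy)
  · have hz0 : 0 < z := by linarith
    have : ContDiffAt ℝ 1 (fun z => φ (z ^ (1 / α)) / (α * z)) z := by
      refine ContDiffAt.div ?_ (by fun_prop) (by positivity)
      have h1 : ContDiff ℝ 1 φ := hs.of_le (by exact_mod_cast le_top)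
      exact h1.contDiffAt.comp z (Real.contDiffAt_rpow_const_of_ne hz0.ne')
    refine this.congr_of_eventuallyEq ?_
    filter_upwards [Ioi_mem_nhds hz0] with y hy
    exact if_pos hy

lemma exists_lipschitz_powDensity (hs : ContDiff ℝ (⊤ : ℕ∞) φ)
    (hφ : Function.support φ ⊆ Set.Ioo 1 2) (hα : 1 ≤ α) (hα2 : α ≤ 2) :
    ∃ A : ℝ, 0 < A ∧ (∀ y z, |powDensity φ α y - powDensity φ α z| ≤ A * |y - z|) ∧
      ∀ z, |powDensity φ α z| ≤ 3 * A := by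
  have hc : HasCompactSupport (powDensity φ α) := by
    refine HasCompactSupport.intro (isCompact_Icc (a := (1 : ℝ)) (b := 4)) fun z hz => ?_
    rw [Set.mem_Icc, not_and_or, not_le, not_le] at hz
    rcases hz with hz | hz
    · exact powDensity_eq_zero_of_le_one hφ hα hz.le
    · exact powDensity_eq_zero_of_four_le hφ hα hα2 hz.le
  obtain ⟨K, hK⟩ := (contDiff_powDensity hs hφ hα).lipschitzWith_of_hasCompactSupport hc one_ne_zero
  have hlip : ∀ y z, |powDensity φ α y - powDensity φ α z| ≤ (K + 1 : ℝ) * |y - z| := fun y z => by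
    have := hK.dist_le_mul y z
    rw [Real.dist_eq, Real.dist_eq] at this
    nlinarith [abs_nonneg (y - z)]
  have hK1 : 0 < (K + 1 : ℝ) := by positivity
  refine ⟨K + 1, hK1, hlip, fun z => ?_⟩
  rcases le_total z 1 with hz | hz
  · rw [powDensity_eq_zero_of_le_one hφ hα hz]; simpa using by positivity
  rcases le_total 4 z with hz4 | hz4
  · rw [powDensity_eq_zero_of_four_le hφ hα hα2 hz4]; simpa using by positivity
  have := hlip z 1
  rw [powDensity_eq_zero_of_le_one hφ hα le_rfl, sub_zero, abs_of_nonneg (by linarith : 0 ≤ z - 1)]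
    at this
  nlinarith

lemma hasDerivAt_powPrimitive (hs : ContDiff ℝ (⊤ : ℕ∞) φ)
    (hφ : Function.support φ ⊆ Set.Ioo 1 2) (hα : 1 ≤ α) (z : ℝ) :
    HasDerivAt (powPrimitive φ α) (powDensity φ α z) z :=
  (contDiff_powDensity hs hφ hα).continuous.integral_hasStrictDerivAt 0 z |>.hasDerivAt

lemma powPrimitive_eq_zero (hφ : Function.support φ ⊆ Set.Ioo 1 2) (hα : 1 ≤ α)
    {z : ℝ} (hz : z ≤ 0) : powPrimitive φ α z = 0 := by
  unfold powPrimitive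
  rw [intervalIntegral.integral_congr (g := fun _ => (0 : ℝ)), intervalIntegral.integral_zero]
  intro s hs
  rw [Set.uIcc_of_ge hz] at hs
  exact powDensity_eq_zero_of_le_one hφ hα (by linarith [hs.2])

lemma powPrimitive_eq_of_four_le (hs : ContDiff ℝ (⊤ : ℕ∞) φ)
    (hφ : Function.support φ ⊆ Set.Ioo 1 2) (hα : 1 ≤ α) (hα2 : α ≤ 2)
    {y z : ℝ} (hy : 4 ≤ y) (hz : 4 ≤ z) : powPrimitive φ α y = powPrimitive φ α z := by
  have hc := (contDiff_powDensity hs hφ hα).continuous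
  unfold powPrimitive
  rw [← sub_eq_zero, intervalIntegral.integral_interval_sub_left (hc.intervalIntegrable _ _)
    (hc.intervalIntegrable _ _), intervalIntegral.integral_congr (g := fun _ => (0 : ℝ)),
    intervalIntegral.integral_zero]
  intro s hs
  exact powDensity_eq_zero_of_four_le hφ hα hα2 ((le_min hz hy).trans hs.1)

/-- The substitution `z = v ^ α`. -/
lemma hasDerivAt_powPrimitive_rpow (hs : ContDiff ℝ (⊤ : ℕ∞) φ)
    (hφ : Function.support φ ⊆ Set.Ioo 1 2) (hα : 1 ≤ α) {v : ℝ} (hv : 0 ≤ v) :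
    HasDerivAt (fun v : ℝ => powPrimitive φ α (v ^ α)) (powDensity φ 1 v) v := by
  have h := (hasDerivAt_powPrimitive hs hφ hα (v ^ α)).comp v
    (Real.hasDerivAt_rpow_const (p := α) (Or.inr hα))
  suffices hd : powDensity φ 1 v = powDensity φ α (v ^ α) * (α * v ^ (α - 1)) by
    rw [hd]; exact h
  rcases hv.eq_or_lt with rfl | hv
  · rw [powDensity_eq_zero_of_le_one hφ le_rfl zero_le_one,
      powDensity_eq_zero_of_le_one hφ hα (by rw [Real.zero_rpow (by linarith)]; exact zero_le_one),
      zero_mul]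
  · have h0 : α ≠ 0 := by linarith
    have h1 : v ^ α = v ^ (α - 1) * v := by
      rw [← Real.rpow_add_one hv.ne', sub_add_cancel]
    have h2 : 0 < v ^ (α - 1) := Real.rpow_pos_of_pos hv _
    simp only [powDensity, hv, Real.rpow_pos_of_pos hv, if_true]
    rw [← Real.rpow_mul hv.le, mul_one_div_cancel h0, h1]
    simp only [div_one, Real.rpow_one, one_mul]
    field_simp

/-- The increments of an antiderivative of a Lipschitz function, compared with the left endpoint. -/
lemma abs_increment_sub_le {u q : ℝ → ℝ} {A : ℝ}
    (hu : ∀ v, 0 ≤ v → HasDerivAt u (q v) v) (hq : ∀ y z, |q y - q z| ≤ A * |y - z|)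
    (hA : 0 ≤ A) {x y : ℝ} (hx : 0 ≤ x) (hxy : x ≤ y) :
    |q x * (y - x) - (u y - u x)| ≤ A * (y - x) ^ 2 := by
  rcases hxy.eq_or_lt with rfl | hxy
  · simp
  obtain ⟨c, hc, hc'⟩ := exists_hasDerivAt_eq_slope u q hxy
    (fun v hv => (hu v (hx.trans hv.1)).continuousAt.continuousWithinAt)
    (fun v hv => hu v (hx.trans hv.1.le))
  have h0 : 0 < y - x := sub_pos.2 hxy
  have h1 : u y - u x = q c * (y - x) := by rw [hc']; field_simp
  rw [h1, ← sub_mul, abs_mul, abs_of_pos h0, sq, ← mul_assoc]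
  refine mul_le_mul_of_nonneg_right ((hq x c).trans ?_) h0.le
  refine mul_le_mul_of_nonneg_left ?_ hA
  rw [abs_sub_comm, abs_of_pos (sub_pos.2 hc.1)]
  linarith [hc.2]

lemma abs_increment_le {u q : ℝ → ℝ} {B : ℝ}
    (hu : ∀ v, 0 ≤ v → HasDerivAt u (q v) v) (hq : ∀ y, |q y| ≤ B)
    {x y : ℝ} (hx : 0 ≤ x) (hxy : x ≤ y) : |u y - u x| ≤ B * (y - x) := by
  have := Convex.norm_image_sub_le_of_norm_hasDerivWithin_le (f := u) (f' := q) (C := B)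
    (s := Set.Ici 0) (x := x) (y := y) (fun v hv => (hu v hv).hasDerivWithinAt) (fun v _ => hq v)
    (convex_Ici 0) hx (hx.trans hxy)
  rwa [Real.norm_eq_abs, Real.norm_eq_abs, abs_of_nonneg (sub_nonneg.2 hxy)] at this

lemma abs_second_difference_le {P p : ℝ → ℝ} {A : ℝ} (hP : ∀ z, HasDerivAt P (p z) z)
    (hp : ∀ y z, |p y - p z| ≤ A * |y - z|) (z s t : ℝ) :
    |(P (z + t + s) - P (z + t)) - (P (z + s) - P z)| ≤ A * |s| * |t| := by
  have := Convex.norm_image_sub_le_of_norm_hasDerivWithin_le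
    (f := fun z => P (z + s) - P z) (f' := fun z => p (z + s) - p z) (C := A * |s|)
    (s := Set.univ) (x := z) (y := z + t)
    (fun v _ => (((hP (v + s)).comp_add_const v s).sub (hP v)).hasDerivWithinAt)
    (fun v _ => by simpa using hp (v + s) v) convex_univ trivial trivial
  simpa using this

/-- `∑_{x < n} μ_N(x)`. -/
def muCumulative (φ : ℝ → ℝ) (α : ℝ) (N : ℕ) (n : ℤ) : ℝ :=
  ∑ m ∈ Finset.Icc N (2 * N),
    if (⌊(m : ℝ) ^ α⌋ : ℤ) < n then φ ((m : ℝ) / (N : ℝ)) / (m : ℝ) else 0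

lemma mu_eq_muCumulative_sub (N : ℕ) (x : ℤ) :
    mu φ α N x = muCumulative φ α N (x + 1) - muCumulative φ α N x := by
  unfold mu muCumulative
  rw [← Finset.sum_sub_distrib]
  refine Finset.sum_congr rfl fun m _ => ?_
  rcases lt_trichotomy (⌊(m : ℝ) ^ α⌋ : ℤ) x with h | h | h
  · simp [h.ne, h, h.trans (lt_add_one x)]
  · simp [h]
  · simp [h.ne', not_lt.2 h.le, not_le.2 h]

lemma mu_eq_zero_of_neg {N : ℕ} {x : ℤ} (hx : x < 0) : mu φ α N x = 0 := by
  refine Finset.sum_eq_zero fun m _ => if_neg fun h => ?_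
  have : (0 : ℤ) ≤ ⌊(m : ℝ) ^ α⌋ := Int.floor_nonneg.2 (by positivity)
  omega

lemma mu_eq_zero_of_lt (hα : 0 ≤ α) (hα2 : α ≤ 2) {N : ℕ} {x : ℤ}
    (hx : 4 * (N : ℝ) ^ α < x) : mu φ α N x = 0 := by
  refine Finset.sum_eq_zero fun m hm => if_neg fun h => ?_
  have h1 : (m : ℝ) ≤ 2 * N := by exact_mod_cast (Finset.mem_Icc.1 hm).2
  have h2 : (m : ℝ) ^ α ≤ 4 * (N : ℝ) ^ α := by
    refine (Real.rpow_le_rpow (by positivity) h1 hα).trans ?_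
    rw [Real.mul_rpow (by norm_num) (by positivity)]
    refine mul_le_mul_of_nonneg_right ?_ (by positivity)
    calc (2 : ℝ) ^ α ≤ 2 ^ (2 : ℝ) := Real.rpow_le_rpow_of_exponent_le (by norm_num) hα2
      _ = 4 := by norm_num
  have h3 := Int.floor_le ((m : ℝ) ^ α)
  rw [h] at h3
  linarith

lemma weight_eq {N : ℕ} (hN : 1 ≤ N) (m : ℕ) :
    φ ((m : ℝ) / N) / m = powDensity φ 1 (m / N) * ((m + 1 : ℝ) / N - m / N) := by
  have hN0 : (0 : ℝ) < N := by exact_mod_cast hN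
  rcases Nat.eq_zero_or_pos m with rfl | hm
  · simp [powDensity]
  · have hm0 : (0 : ℝ) < m := by exact_mod_cast hm
    rw [powDensity, if_pos (by positivity), div_one, Real.rpow_one]
    field_simp
    ring

lemma muCumulative_eq (hφ : Function.support φ ⊆ Set.Ioo 1 2) (hα : 1 ≤ α) {N : ℕ} (hN : 1 ≤ N)
    {n : ℤ} (hn : 0 < n) :
    muCumulative φ α N n =
      ∑ m ∈ Finset.range ⌈(n : ℝ) ^ (1 / α)⌉₊, φ ((m : ℝ) / N) / m := by
  have hN0 : (0 : ℝ) < N := by exact_mod_cast hN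
  have hn0 : (0 : ℝ) < n := by exact_mod_cast hn
  have key : ∀ m : ℕ, (⌊(m : ℝ) ^ α⌋ : ℤ) < n ↔ m < ⌈(n : ℝ) ^ (1 / α)⌉₊ := fun m => by
    rw [Int.floor_lt, Nat.lt_ceil, one_div,
      Real.lt_rpow_inv_iff_of_pos (by positivity) hn0.le (by linarith)]
  simp only [muCumulative, key]
  rw [← Finset.sum_filter]
  refine Finset.sum_subset (fun m hm => Finset.mem_range.2 (Finset.mem_filter.1 hm).2)
    fun m hm hm' => ?_
  have h0 : φ ((m : ℝ) / N) = 0 := by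
    by_contra h
    obtain ⟨h1, h2⟩ := hφ h
    rw [lt_div_iff₀ hN0, one_mul] at h1
    rw [div_lt_iff₀ hN0] at h2
    refine hm' (Finset.mem_filter.2 ⟨Finset.mem_Icc.2 ⟨?_, ?_⟩, Finset.mem_range.1 hm⟩)
    · exact_mod_cast h1.le
    · exact_mod_cast h2.le
  rw [h0, zero_div]

lemma abs_muCumulative_sub_le (hs : ContDiff ℝ (⊤ : ℕ∞) φ)
    (hφ : Function.support φ ⊆ Set.Ioo 1 2) (hα : 1 ≤ α) {A : ℝ} (hA : 0 ≤ A)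
    (hq : ∀ y z, |powDensity φ 1 y - powDensity φ 1 z| ≤ A * |y - z|)
    (hB : ∀ z, |powDensity φ 1 z| ≤ 3 * A) {N : ℕ} (hN : 1 ≤ N) (n : ℤ) :
    |muCumulative φ α N n - powPrimitive φ α (n / (N : ℝ) ^ α)| ≤ 5 * A / N := by
  have hN0 : (0 : ℝ) < N := by exact_mod_cast hN
  rcases le_or_gt n 0 with hn | hn
  · have hn0 : (n : ℝ) ≤ 0 := by exact_mod_cast hn
    rw [powPrimitive_eq_zero hφ hα (div_nonpos_of_nonpos_of_nonneg hn0 (by positivity)),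
      muCumulative, Finset.sum_eq_zero]
    · rw [sub_zero, abs_zero]; positivity
    · intro m _
      have : (0 : ℤ) ≤ ⌊(m : ℝ) ^ α⌋ := Int.floor_nonneg.2 (by positivity)
      exact if_neg (by omega)
  have hn0 : (0 : ℝ) < n := by exact_mod_cast hn
  rw [muCumulative_eq hφ hα hN hn]
  set s : ℝ := (n : ℝ) ^ (1 / α) with hs_def
  have hs0 : 0 ≤ s := by positivity
  set K := ⌈s⌉₊
  set u : ℝ → ℝ := fun v => powPrimitive φ α (v ^ α) with hu_def
  have hu : ∀ v, 0 ≤ v → HasDerivAt u (powDensity φ 1 v) v := fun v hv =>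
    hasDerivAt_powPrimitive_rpow hs hφ hα hv
  have hus : powPrimitive φ α (n / (N : ℝ) ^ α) = u (s / N) := by
    simp only [hu_def]
    rw [Real.div_rpow hs0 hN0.le, hs_def, ← Real.rpow_mul hn0.le,
      one_div_mul_cancel (by linarith), Real.rpow_one]
  have hu0 : u ((0 : ℕ) / N) = 0 := by
    simp only [hu_def, Nat.cast_zero, zero_div]
    rw [Real.zero_rpow (by linarith)]
    exact powPrimitive_eq_zero hφ hα le_rfl
  have htel : u ((K : ℕ) / N) = ∑ m ∈ Finset.range K, (u ((m + 1 : ℕ) / N) - u ((m : ℕ) / N)) := by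
    rw [Finset.sum_range_sub (fun m : ℕ => u ((m : ℝ) / N)), hu0, sub_zero]
  have hterm : ∀ m ∈ Finset.range K,
      |φ ((m : ℝ) / N) / m - (u ((m + 1 : ℕ) / N) - u ((m : ℕ) / N))| ≤
        if m < 2 * N then A * (1 / N) ^ 2 else 0 := by
    intro m _
    have hm : (m : ℝ) / N ≤ (m + 1 : ℝ) / N := by gcongr; linarith
    have hd : (m + 1 : ℝ) / N - m / N = 1 / N := by ring
    split_ifs with h
    · have := abs_increment_sub_le hu hq hA (by positivity) hm
      rw [← weight_eq hN, hd] at this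
      exact_mod_cast this
    · have h2 : (2 : ℝ) ≤ m / N := by
        rw [le_div_iff₀ hN0]; exact_mod_cast not_lt.1 h
      have hz : ∀ v, 2 ≤ v → φ v = 0 := fun v hv => by
        by_contra h
        exact absurd (hφ h).2 (not_lt.2 hv)
      have hconst : u ((m + 1 : ℝ) / N) - u (m / N) = 0 := by
        obtain ⟨c, hc, hc'⟩ := exists_hasDerivAt_eq_slope u (powDensity φ 1)
          (a := (m : ℝ) / N) (b := (m + 1 : ℝ) / N) (by gcongr; linarith)
          (fun v hv => (hu v (by linarith [hv.1])).continuousAt.continuousWithinAt)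
          (fun v hv => hu v (by linarith [hv.1]))
        have : powDensity φ 1 c = 0 := by
          rw [powDensity, div_one, Real.rpow_one, hz c (by linarith [hc.1]), zero_div, ite_self]
        rw [this, hd] at hc'
        have := hc'.symm
        rcases div_eq_zero_iff.1 this with h | h
        · exact h
        · exact absurd h (by positivity)
      push_cast
      rw [hz _ h2, hconst]
      simp
  have hsum : |∑ m ∈ Finset.range K, φ ((m : ℝ) / N) / m - u (K / N)| ≤ 2 * A / N := by
    rw [htel, ← Finset.sum_sub_distrib]
    refine (Finset.abs_sum_le_sum_abs _ _).trans ((Finset.sum_le_sum hterm).trans ?_)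
    rw [← Finset.sum_filter, Finset.sum_const, nsmul_eq_mul]
    have hcard : (((Finset.range K).filter (· < 2 * N)).card : ℝ) ≤ 2 * N := by
      have : ((Finset.range K).filter (· < 2 * N)).card ≤ (Finset.range (2 * N)).card :=
        Finset.card_le_card fun m hm => Finset.mem_range.2 (Finset.mem_filter.1 hm).2
      rw [Finset.card_range] at this
      exact_mod_cast this
    calc _ ≤ 2 * N * (A * (1 / N : ℝ) ^ 2) := by gcongr
      _ = 2 * A / N := by field_simp
  have hend : |u (K / N) - u (s / N)| ≤ 3 * A / N := by
    refine (abs_increment_le hu hB (by positivity) (by gcongr; exact Nat.le_ceil s)).trans ?_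
    rw [← sub_div, ← mul_div_assoc]
    refine div_le_div_of_nonneg_right ?_ hN0.le
    nlinarith [Nat.ceil_lt_add_one hs0]
  rw [hus]
  calc _ ≤ _ := abs_sub_le _ (u (K / N)) _
    _ ≤ 2 * A / N + 3 * A / N := add_le_add hsum hend
    _ = 5 * A / N := by ring

lemma sum_Icc_telescope (f : ℤ → ℝ) (x : ℤ) {a b : ℤ} (hab : a ≤ b) :
    ∑ y ∈ Finset.Icc a b, (f (x - y + 1) - f (x - y)) = f (x - a + 1) - f (x - b) := by
  induction b, hab using Int.leInduction with
  | base => simp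
  | succ b hb ih =>
    have : Finset.Icc a (b + 1) = insert (b + 1) (Finset.Icc a b) := by
      ext y; simp only [Finset.mem_Icc, Finset.mem_insert]; omega
    rw [this, Finset.sum_insert (by simp), ih, show x - (b + 1) + 1 = x - b by ring]
    ring

/-- A finite partial sum of a bounded function with support in `S` is at most `c * |S|`. -/
lemma sum_le_mul_card {ι : Type*} [DecidableEq ι] {g : ι → ℝ} {c : ℝ} (hc : 0 ≤ c) (S : Finset ι)
    (hg : ∀ x, g x ≤ c) (hS : ∀ x, x ∉ S → g x = 0) (s : Finset ι) :
    ∑ x ∈ s, g x ≤ c * S.card := by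
  calc ∑ x ∈ s, g x ≤ ∑ x ∈ s, if x ∈ S then c else 0 := by
        refine Finset.sum_le_sum fun x _ => ?_
        split_ifs with h
        · exact hg x
        · exact (hS x h).le
    _ = (s.filter (· ∈ S)).card * c := by rw [← Finset.sum_filter, Finset.sum_const, nsmul_eq_mul]
    _ ≤ S.card * c := by
        gcongr
        exact fun x hx => (Finset.mem_filter.1 hx).2
    _ = c * S.card := mul_comm _ _

/-- The smooth approximation of `μ_N`. -/
def muSmooth (φ : ℝ → ℝ) (α T : ℝ) (n : ℤ) : ℝ :=
  powPrimitive φ α ((n + 1 : ℤ) / T) - powPrimitive φ α (n / T)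

lemma muSmooth_eq_zero (hs : ContDiff ℝ (⊤ : ℕ∞) φ) (hφ : Function.support φ ⊆ Set.Ioo 1 2)
    (hα : 1 ≤ α) (hα2 : α ≤ 2) {T : ℝ} (hT : 0 < T) {n : ℤ} (hn : n < 0 ∨ 4 * T < n) :
    muSmooth φ α T n = 0 := by
  unfold muSmooth
  rcases hn with hn | hn
  · have h1 : ((n + 1 : ℤ) : ℝ) ≤ 0 := by exact_mod_cast hn
    have h2 : (n : ℝ) ≤ 0 := by exact_mod_cast hn.le
    rw [powPrimitive_eq_zero hφ hα (div_nonpos_of_nonpos_of_nonneg h1 hT.le),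
      powPrimitive_eq_zero hφ hα (div_nonpos_of_nonpos_of_nonneg h2 hT.le), sub_zero]
  · rw [sub_eq_zero]
    refine powPrimitive_eq_of_four_le hs hφ hα hα2 ?_ ?_ <;> rw [le_div_iff₀ hT]
    · push_cast; linarith
    · exact hn.le

lemma min_le_rpow {r δ : ℝ} (hr : 0 ≤ r) (hδ0 : 0 ≤ δ) (hδ1 : δ ≤ 1) : min r 1 ≤ r ^ δ := by
  rcases le_total r 1 with h | h
  · rw [min_eq_left h]
    exact Real.self_le_rpow_of_le_one hr h hδ1
  · rw [min_eq_right h]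
    exact Real.one_le_rpow h hδ0

lemma sum_abs_muSmooth_shift_le (hs : ContDiff ℝ (⊤ : ℕ∞) φ)
    (hφ : Function.support φ ⊆ Set.Ioo 1 2) (hα : 1 ≤ α) (hα2 : α ≤ 2) {A : ℝ} (hA : 0 ≤ A)
    (hp : ∀ y z, |powDensity φ α y - powDensity φ α z| ≤ A * |y - z|)
    (hB : ∀ z, |powDensity φ α z| ≤ 3 * A) {T : ℝ} (hT : 1 ≤ T) {δ : ℝ} (hδ0 : 0 ≤ δ)
    (hδ1 : δ ≤ 1) (h y : ℤ) (s : Finset ℤ) :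
    ∑ x ∈ s, |muSmooth φ α T (x + h - y) - muSmooth φ α T (x - y)| ≤
      72 * A * (((|h| : ℤ) : ℝ) / T) ^ δ := by
  have hT0 : 0 < T := by linarith
  set r : ℝ := ((|h| : ℤ) : ℝ) / T with hr_def
  have hr : 0 ≤ r := by positivity
  have hP := hasDerivAt_powPrimitive hs hφ hα
  have hd : ∀ n : ℤ, |muSmooth φ α T n| ≤ 3 * A * (1 / T) := fun n => by
    have := Convex.norm_image_sub_le_of_norm_hasDerivWithin_le (f := powPrimitive φ α)
      (f' := powDensity φ α) (C := 3 * A) (s := Set.univ) (x := (n : ℝ) / T)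
      (y := ((n + 1 : ℤ) : ℝ) / T) (fun v _ => (hP v).hasDerivWithinAt) (fun v _ => hB v)
      convex_univ trivial trivial
    have h1 : ((n + 1 : ℤ) : ℝ) / T - n / T = 1 / T := by push_cast; ring
    rwa [Real.norm_eq_abs, Real.norm_eq_abs, h1, abs_of_pos (by positivity : 0 < 1 / T)] at this
  have hpt : ∀ x : ℤ, |muSmooth φ α T (x + h - y) - muSmooth φ α T (x - y)| ≤
      6 * A * r ^ δ / T := fun x => by
    have h1 : |muSmooth φ α T (x + h - y) - muSmooth φ α T (x - y)| ≤ 6 * A / T * 1 := by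
      calc _ ≤ |muSmooth φ α T (x + h - y)| + |muSmooth φ α T (x - y)| := abs_sub _ _
        _ ≤ 3 * A * (1 / T) + 3 * A * (1 / T) := add_le_add (hd _) (hd _)
        _ = 6 * A / T * 1 := by ring
    have h2 : |muSmooth φ α T (x + h - y) - muSmooth φ α T (x - y)| ≤ 6 * A / T * r := by
      have := abs_second_difference_le hP hp (((x - y : ℤ) : ℝ) / T) (1 / T) ((h : ℝ) / T)
      have e1 : ((x - y : ℤ) : ℝ) / T + h / T + 1 / T = ((x + h - y + 1 : ℤ) : ℝ) / T := by
        push_cast; ring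
      have e2 : ((x - y : ℤ) : ℝ) / T + h / T = ((x + h - y : ℤ) : ℝ) / T := by push_cast; ring
      have e3 : ((x - y : ℤ) : ℝ) / T + 1 / T = ((x - y + 1 : ℤ) : ℝ) / T := by push_cast; ring
      have e4 : |(h : ℝ) / T| = r := by
        rw [abs_div, abs_of_pos hT0, hr_def, Int.cast_abs]
      rw [e1, e2, e3, e4, abs_of_pos (by positivity : 0 < 1 / T)] at this
      refine this.trans ?_
      have : A * (1 / T) * r = A / T * r := by ring
      rw [this]
      gcongr
      linarith
    calc _ ≤ 6 * A / T * min r 1 := by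
          rcases min_choice r 1 with h | h <;> rw [h] <;> assumption
      _ ≤ 6 * A / T * r ^ δ := by gcongr; exact min_le_rpow hr hδ0 hδ1
      _ = 6 * A * r ^ δ / T := by ring
  set R := ⌈4 * T⌉₊
  have hR1 : 4 * T ≤ R := Nat.le_ceil _
  have hR2 : (R : ℝ) < 4 * T + 1 := Nat.ceil_lt_add_one (by positivity)
  have hz : ∀ n : ℤ, n < 0 ∨ (R : ℤ) < n → muSmooth φ α T n = 0 := fun n hn =>
    muSmooth_eq_zero hs hφ hα hα2 hT0 (hn.imp_right fun hn => hR1.trans_lt (by exact_mod_cast hn))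
  refine (sum_le_mul_card (by positivity) (Finset.Icc y (y + R) ∪ Finset.Icc (y - h) (y - h + R))
    hpt (fun x hx => ?_) s).trans ?_
  · simp only [Finset.mem_union, Finset.mem_Icc] at hx
    rw [hz _ (by omega), hz (x - y) (by omega), sub_zero, abs_zero]
  · have hcard : ((Finset.Icc y (y + R) ∪ Finset.Icc (y - h) (y - h + R)).card : ℝ) ≤ 12 * T := by
      have h1 := Finset.card_union_le (Finset.Icc y (y + R)) (Finset.Icc (y - h) (y - h + R))
      rw [Int.card_Icc, Int.card_Icc] at h1
      have h2 : (Finset.Icc y (y + R) ∪ Finset.Icc (y - h) (y - h + R)).card ≤ 2 * R + 2 := by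
        omega
      have h3 : ((Finset.Icc y (y + R) ∪ Finset.Icc (y - h) (y - h + R)).card : ℝ) ≤ 2 * R + 2 := by
        exact_mod_cast h2
      linarith
    calc _ ≤ 6 * A * r ^ δ / T * (12 * T) := by gcongr
      _ = 72 * A * r ^ δ := by field_simp; ring

/-- The convolution of `1_Q` with the error `μ_N - muSmooth` telescopes. -/
lemma sum_abs_convolution_error_le (hs : ContDiff ℝ (⊤ : ℕ∞) φ)
    (hφ : Function.support φ ⊆ Set.Ioo 1 2) (hα : 1 ≤ α) (hα2 : α ≤ 2) {A : ℝ} (hA : 0 ≤ A)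
    (hq : ∀ y z, |powDensity φ 1 y - powDensity φ 1 z| ≤ A * |y - z|)
    (hB : ∀ z, |powDensity φ 1 z| ≤ 3 * A) {N : ℕ} (hN : 1 ≤ N) {a b : ℤ} (hab : a ≤ b) (h : ℤ)
    (s : Finset ℤ) :
    ∑ x ∈ s, |∑ y ∈ Finset.Icc a b,
        (mu φ α N (x + h - y) - muSmooth φ α ((N : ℝ) ^ α) (x + h - y))| ≤
      10 * A / N * ((Finset.Icc a b).card + 5 * (N : ℝ) ^ α) := by
  have hN1 : (1 : ℝ) ≤ N := by exact_mod_cast hN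
  set T := (N : ℝ) ^ α
  have hT : 1 ≤ T := Real.one_le_rpow hN1 (by linarith)
  set E : ℤ → ℝ := fun n => muCumulative φ α N n - powPrimitive φ α (n / T) with hE
  have hEb : ∀ n, |E n| ≤ 5 * A / N := fun n => abs_muCumulative_sub_le hs hφ hα hA hq hB hN n
  set R := ⌈4 * T⌉₊
  have hR1 : 4 * T ≤ R := Nat.le_ceil _
  have hR2 : (R : ℝ) < 4 * T + 1 := Nat.ceil_lt_add_one (by positivity)
  refine (sum_le_mul_card (by positivity) (Finset.Icc (a - h) (b - h + R))
    (c := 10 * A / N) (fun x => ?_) (fun x hx => ?_) s).trans ?_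
  · have : ∑ y ∈ Finset.Icc a b, (mu φ α N (x + h - y) - muSmooth φ α T (x + h - y)) =
        E (x + h - a + 1) - E (x + h - b) := by
      rw [← sum_Icc_telescope E (x + h) hab]
      refine Finset.sum_congr rfl fun y _ => ?_
      rw [mu_eq_muCumulative_sub, muSmooth]
      simp only [hE]
      ring
    rw [this]
    calc _ ≤ |E (x + h - a + 1)| + |E (x + h - b)| := abs_sub _ _
      _ ≤ 5 * A / N + 5 * A / N := add_le_add (hEb _) (hEb _)
      _ = 10 * A / N := by ring
  · rw [Finset.mem_Icc] at hx
    rw [Finset.sum_eq_zero, abs_zero]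
    intro y hy
    rw [Finset.mem_Icc] at hy
    rcases (show x + h - y < 0 ∨ (R : ℤ) < x + h - y by omega) with hn | hn
    · rw [mu_eq_zero_of_neg hn, muSmooth_eq_zero hs hφ hα hα2 (by linarith) (Or.inl hn), sub_zero]
    · have hn' : 4 * T < ((x + h - y : ℤ) : ℝ) := hR1.trans_lt (by exact_mod_cast hn)
      rw [mu_eq_zero_of_lt (by linarith) hα2 hn',
        muSmooth_eq_zero hs hφ hα hα2 (by linarith) (Or.inr hn'), sub_zero]
  · have hcard : ((Finset.Icc (a - h) (b - h + R)).card : ℝ) = (Finset.Icc a b).card + R := by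
      rw [Int.card_Icc, Int.card_Icc]
      have : (b - h + R + 1 - (a - h)).toNat = (b + 1 - a).toNat + R := by omega
      exact_mod_cast this
    rw [hcard]
    gcongr
    linarith

lemma sum_abs_rhoNQ_shift_le (hs : ContDiff ℝ (⊤ : ℕ∞) φ)
    (hφ : Function.support φ ⊆ Set.Ioo 1 2) (hα : 1 ≤ α) (hα2 : α ≤ 2) {ε : ℝ} (hε : 0 < ε)
    (hε1 : ε ≤ 1) {A : ℝ} (hA : 0 ≤ A)
    (hq : ∀ y z, |powDensity φ 1 y - powDensity φ 1 z| ≤ A * |y - z|)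
    (hqB : ∀ z, |powDensity φ 1 z| ≤ 3 * A) {A' : ℝ} (hA' : 0 ≤ A')
    (hp : ∀ y z, |powDensity φ α y - powDensity φ α z| ≤ A' * |y - z|)
    (hpB : ∀ z, |powDensity φ α z| ≤ 3 * A') {N : ℕ} (hN : 1 ≤ N) {a b : ℤ} (hab : a ≤ b)
    (hL : (N : ℝ) ^ (α - 1 + ε) ≤ (Finset.Icc a b).card) {h : ℤ} (hh : h ≠ 0) (s : Finset ℤ) :
    ∑ x ∈ s, |rhoNQ φ α N a b (x + h) - rhoNQ φ α N a b x| ≤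
      (72 * A' + 120 * A) * (((|h| : ℤ) : ℝ) / (N : ℝ) ^ α) ^ (ε / α) := by
  have hN1 : (1 : ℝ) ≤ N := by exact_mod_cast hN
  have hN0 : (0 : ℝ) < N := by linarith
  set T := (N : ℝ) ^ α with hT_def
  have hT : 1 ≤ T := Real.one_le_rpow hN1 (by linarith)
  set L : ℝ := ((Finset.Icc a b).card : ℝ) with hL_def
  have hL0 : 0 < L := (Real.rpow_pos_of_pos hN0 _).trans_le hL
  set r : ℝ := ((|h| : ℤ) : ℝ) / T with hr_def
  have hα0 : 0 < α := by linarith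
  have hr : (N : ℝ) ^ (-ε) ≤ r ^ (ε / α) := by
    have h1 : (1 : ℝ) ≤ ((|h| : ℤ) : ℝ) := by exact_mod_cast Int.one_le_abs hh
    calc (N : ℝ) ^ (-ε) = (T⁻¹) ^ (ε / α) := by
          rw [hT_def, ← Real.rpow_neg hN0.le, ← Real.rpow_mul hN0.le]
          congr 1
          field_simp
      _ ≤ r ^ (ε / α) := by
          refine Real.rpow_le_rpow (by positivity) ?_ (by positivity)
          rw [hr_def, inv_eq_one_div]
          gcongr
  set d := muSmooth φ α T
  set W : ℤ → ℝ := fun x => ∑ y ∈ Finset.Icc a b, (mu φ α N (x - y) - d (x - y)) with hW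
  have hsplit : ∀ x, rhoNQ φ α N a b (x + h) - rhoNQ φ α N a b x =
      1 / L * (∑ y ∈ Finset.Icc a b, (d (x + h - y) - d (x - y)) + (W (x + h) - W x)) := fun x => by
    simp only [rhoNQ, hW, Finset.sum_sub_distrib, ← hL_def]
    ring
  have hsmooth : ∑ x ∈ s, ∑ y ∈ Finset.Icc a b, |d (x + h - y) - d (x - y)| ≤
      L * (72 * A' * r ^ (ε / α)) := by
    rw [Finset.sum_comm]
    refine (Finset.sum_le_card_nsmul _ _ _ fun y _ => ?_).trans_eq (nsmul_eq_mul _ _)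
    exact sum_abs_muSmooth_shift_le hs hφ hα hα2 hA' hp hpB hT (by positivity)
      ((div_le_one hα0).2 (hε1.trans hα)) h y s
  have herr : ∀ h' : ℤ, ∑ x ∈ s, |W (x + h')| ≤ 10 * A / N * (L + 5 * T) := fun h' =>
    sum_abs_convolution_error_le hs hφ hα hα2 hA hq hqB hN hab h' s
  have herr0 : ∑ x ∈ s, |W x| ≤ 10 * A / N * (L + 5 * T) := by simpa using herr 0
  have hscale : (L + 5 * T) / (N * L) ≤ 6 * r ^ (ε / α) := by
    refine le_trans ?_ (mul_le_mul_of_nonneg_left hr (by norm_num))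
    have h1 : (N : ℝ)⁻¹ ≤ (N : ℝ) ^ (-ε) := by
      rw [← Real.rpow_neg_one]
      exact Real.rpow_le_rpow_of_exponent_le hN1 (by linarith)
    have h2 : T / (N * L) ≤ (N : ℝ) ^ (-ε) := by
      rw [div_le_iff₀ (by positivity)]
      calc T = (N : ℝ) ^ (-ε) * (N * (N : ℝ) ^ (α - 1 + ε)) := by
            rw [← Real.rpow_one_add' hN0.le (by linarith), ← Real.rpow_add hN0,
              hT_def]
            congr 1
            ring
        _ ≤ (N : ℝ) ^ (-ε) * (N * L) := by gcongr
    calc (L + 5 * T) / (N * L) = (N : ℝ)⁻¹ + 5 * (T / (N * L)) := by field_simp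
      _ ≤ 6 * (N : ℝ) ^ (-ε) := by linarith
  calc ∑ x ∈ s, |rhoNQ φ α N a b (x + h) - rhoNQ φ α N a b x|
      ≤ ∑ x ∈ s, 1 / L * (∑ y ∈ Finset.Icc a b, |d (x + h - y) - d (x - y)| +
          (|W (x + h)| + |W x|)) := by
        refine Finset.sum_le_sum fun x _ => ?_
        rw [hsplit, abs_mul, abs_of_pos (by positivity : 0 < 1 / L)]
        gcongr
        exact (abs_add_le _ _).trans
          (add_le_add (Finset.abs_sum_le_sum_abs _ _) (abs_sub _ _))
    _ = 1 / L * (∑ x ∈ s, ∑ y ∈ Finset.Icc a b, |d (x + h - y) - d (x - y)| +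
          (∑ x ∈ s, |W (x + h)| + ∑ x ∈ s, |W x|)) := by
        rw [← Finset.mul_sum, Finset.sum_add_distrib, Finset.sum_add_distrib]
    _ ≤ 1 / L * (L * (72 * A' * r ^ (ε / α)) +
          (10 * A / N * (L + 5 * T) + 10 * A / N * (L + 5 * T))) := by
        gcongr
        exact herr h
    _ = 72 * A' * r ^ (ε / α) + 20 * A * ((L + 5 * T) / (N * L)) := by field_simp; ring
    _ ≤ 72 * A' * r ^ (ε / α) + 20 * A * (6 * r ^ (ε / α)) := by gcongr
    _ = (72 * A' + 120 * A) * r ^ (ε / α) := by ring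

end

/-- `ℓ¹` Hölder regularity of `ρ_{N,Q} = μ_N ∗ (1_Q/|Q|)` for intervals `Q` of length
`≥ M^{α−1+ε}`: `Σ_x |ρ_{N,Q}(x+h) − ρ_{N,Q}(x)| ≤ C (|h|/N^α)^δ`. -/
theorem l1_holder_regularity (α : ℝ) (hα₁ : 1 < α) (hα₂ : α ≤ 1 + 1 / 1000)
    (ε : ℝ) (hε : 0 < ε) :
    ∃ θ₀ : ℝ, 0 < θ₀ ∧ θ₀ < 1 ∧
      ∀ θ : ℝ, θ₀ < θ → θ < 1 →
      ∀ φ : ℝ → ℝ, ContDiff ℝ (⊤ : ℕ∞) φ → Function.support φ ⊆ Set.Ioo 1 2 →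
      ∃ δ C : ℝ, 0 < δ ∧ 0 < C ∧
      ∀ (KM k : ℕ) (a b : ℤ), a ≤ b →
        ((2 : ℝ) ^ KM) ^ (α - 1 + ε) ≤ ((Finset.Icc a b).card : ℝ) →
        ((2 : ℝ) ^ KM) ^ θ ≤ (2 : ℝ) ^ k → (2 : ℝ) ^ k ≤ (2 : ℝ) ^ KM →
        ∀ h : ℤ,
          ∑' x : ℤ, |rhoNQ φ α (2 ^ k) a b (x + h) - rhoNQ φ α (2 ^ k) a b x| ≤
            C * (((|h| : ℤ) : ℝ) / ((2 : ℝ) ^ k) ^ α) ^ δ := by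
  have hα2 : α ≤ 2 := by linarith
  refine ⟨1 / 2, by norm_num, by norm_num, fun θ _ _ φ hs hφ => ?_⟩
  obtain ⟨A, hA, hq, hqB⟩ := exists_lipschitz_powDensity hs hφ le_rfl one_le_two
  obtain ⟨A', hA', hp, hpB⟩ := exists_lipschitz_powDensity hs hφ hα₁.le hα2
  have hε' : 0 < min ε 1 := lt_min hε one_pos
  refine ⟨min ε 1 / α, 72 * A' + 120 * A, by positivity, by positivity, ?_⟩
  intro KM k a b hab hL _ hk h
  rcases eq_or_ne h 0 with rfl | hh
  · have : 0 < min ε 1 / α := by positivity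
    simp [Real.zero_rpow this.ne']
  have hN : 1 ≤ 2 ^ k := Nat.one_le_two_pow
  have hL' : ((2 ^ k : ℕ) : ℝ) ^ (α - 1 + min ε 1) ≤ (Finset.Icc a b).card := by
    push_cast
    have h1 : (1 : ℝ) ≤ 2 ^ k := by exact_mod_cast hN
    refine le_trans ?_ hL
    calc ((2 : ℝ) ^ k) ^ (α - 1 + min ε 1) ≤ ((2 : ℝ) ^ k) ^ (α - 1 + ε) :=
          Real.rpow_le_rpow_of_exponent_le h1 (by linarith [min_le_left ε 1])
      _ ≤ ((2 : ℝ) ^ KM) ^ (α - 1 + ε) :=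
          Real.rpow_le_rpow (by positivity) hk (by linarith)
  refine Real.tsum_le_of_sum_le (fun _ => abs_nonneg _) fun s => ?_
  have := sum_abs_rhoNQ_shift_le hs hφ hα₁.le hα2 hε' (min_le_right _ _) hA.le hq hqB hA'.le hp hpB
    hN hab hL' hh s
  exact_mod_cast this
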